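/- For each n ∈ ℕ, WRΣ0(Σ_n) proves BΣ_{n+2}: every model of IΔ0 satisfying the weak regularity principle for all Σ0(Σ_n) formulas satisfies the Σ_{n+2}-collection scheme. -/

import Mathlib

namespace PaperArith

/-! ## Syntax of (two-sorted) first-order arithmetic

Terms and formulas of arithmetic in the language `{0, 1, +, ·, <}`,
with number variables and (monadic second-order) set variables both indexed
by natural numbers.  Bounded quantifiers are taken as primitives, so that the
class `Δ₀` of bounded formulas is a purely syntactic class. -/

/-- Terms of first-order arithmetic in the language `{0, 1, +, ·, <}`. -/
inductive Term : Type
  | var : ℕ → Term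
  | zero : Term
  | one : Term
  | add : Term → Term → Term
  | mul : Term → Term → Term

/-- Formulas of (two-sorted) arithmetic.  `mem t i` is the atomic formula
`t ∈ Xᵢ`; `ball x t φ` is `∀ x < t, φ` and `bex x t φ` is `∃ x < t, φ`;
`sall i φ` and `sex i φ` quantify over the set variable `Xᵢ`.
Purely first-order formulas are those avoiding `mem`, `sall`, `sex`. -/
inductive Fml : Type
  | eq : Term → Term → Fml
  | lt : Term → Term → Fml
  | mem : Term → ℕ → Fml
  | not : Fml → Fml
  | and : Fml → Fml → Fml
  | or : Fml → Fml → Fml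
  | imp : Fml → Fml → Fml
  | all : ℕ → Fml → Fml
  | ex : ℕ → Fml → Fml
  | ball : ℕ → Term → Fml → Fml
  | bex : ℕ → Term → Fml → Fml
  | sall : ℕ → Fml → Fml
  | sex : ℕ → Fml → Fml

/-- A structure for the first-order language of arithmetic. -/
structure Str : Type 1 where
  M : Type
  zero : M
  one : M
  add : M → M → M
  mul : M → M → M
  lt : M → M → Prop

/-- Value of a term under a valuation of the number variables. -/
def tval (S : Str) (v : ℕ → S.M) : Term → S.M
  | .var i => v i
  | .zero => S.zero
  | .one => S.one
  | .add t u => S.add (tval S v t) (tval S v u)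
  | .mul t u => S.mul (tval S v t) (tval S v u)

/-- Update a valuation at one variable. -/
def upd {α : Type} (v : ℕ → α) (x : ℕ) (a : α) : ℕ → α :=
  fun i => if i = x then a else v i

/-- Tarskian satisfaction over the structure `S`, with second-order universe
`X` (set quantifiers range over `X`); `v` is the valuation of number
variables, `w` the valuation of set variables. -/
def Sat (S : Str) (X : Set (Set S.M)) : (ℕ → S.M) → (ℕ → Set S.M) → Fml → Prop
  | v, _, .eq t u => tval S v t = tval S v u
  | v, _, .lt t u => S.lt (tval S v t) (tval S v u)
  | v, w, .mem t i => tval S v t ∈ w i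
  | v, w, .not φ => ¬ Sat S X v w φ
  | v, w, .and φ ψ => Sat S X v w φ ∧ Sat S X v w ψ
  | v, w, .or φ ψ => Sat S X v w φ ∨ Sat S X v w ψ
  | v, w, .imp φ ψ => Sat S X v w φ → Sat S X v w ψ
  | v, w, .all x φ => ∀ m : S.M, Sat S X (upd v x m) w φ
  | v, w, .ex x φ => ∃ m : S.M, Sat S X (upd v x m) w φ
  | v, w, .ball x t φ => ∀ m : S.M, S.lt m (tval S v t) → Sat S X (upd v x m) w φ
  | v, w, .bex x t φ => ∃ m : S.M, S.lt m (tval S v t) ∧ Sat S X (upd v x m) w φ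
  | v, w, .sall i φ => ∀ A : Set S.M, A ∈ X → Sat S X v (upd w i A) φ
  | v, w, .sex i φ => ∃ A : Set S.M, A ∈ X ∧ Sat S X v (upd w i A) φ

/-- First-order satisfaction (for purely first-order formulas the second-order
data is irrelevant). -/
def Sat0 (S : Str) (v : ℕ → S.M) (φ : Fml) : Prop :=
  Sat S ∅ v (fun _ => ∅) φ

/-! ## The arithmetic hierarchy -/

/-- `Δ₀` formulas: purely first-order, only bounded quantifiers. -/
inductive Delta0 : Fml → Prop
  | eq (t u : Term) : Delta0 (.eq t u)
  | lt (t u : Term) : Delta0 (.lt t u)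
  | not {φ : Fml} : Delta0 φ → Delta0 (.not φ)
  | and {φ ψ : Fml} : Delta0 φ → Delta0 ψ → Delta0 (.and φ ψ)
  | or {φ ψ : Fml} : Delta0 φ → Delta0 ψ → Delta0 (.or φ ψ)
  | imp {φ ψ : Fml} : Delta0 φ → Delta0 ψ → Delta0 (.imp φ ψ)
  | ball (x : ℕ) (t : Term) {φ : Fml} : Delta0 φ → Delta0 (.ball x t φ)
  | bex (x : ℕ) (t : Term) {φ : Fml} : Delta0 φ → Delta0 (.bex x t φ)

mutual
  /-- `Σₙ` formulas of the first-order arithmetic hierarchy. -/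
  inductive IsSigma : ℕ → Fml → Prop
    | delta0 {n : ℕ} {φ : Fml} : Delta0 φ → IsSigma n φ
    | ofPi {n : ℕ} {φ : Fml} : IsPi n φ → IsSigma (n + 1) φ
    | ex (x : ℕ) {n : ℕ} {φ : Fml} : IsSigma (n + 1) φ → IsSigma (n + 1) (.ex x φ)
  /-- `Πₙ` formulas of the first-order arithmetic hierarchy. -/
  inductive IsPi : ℕ → Fml → Prop
    | delta0 {n : ℕ} {φ : Fml} : Delta0 φ → IsPi n φ
    | ofSigma {n : ℕ} {φ : Fml} : IsSigma n φ → IsPi (n + 1) φ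
    | all (x : ℕ) {n : ℕ} {φ : Fml} : IsPi (n + 1) φ → IsPi (n + 1) (.all x φ)
end

/-- `Σ₀(Σₙ)`: the closure of `Σₙ` under Boolean operations and bounded
quantification. -/
inductive Sigma0Sigma (n : ℕ) : Fml → Prop
  | ofSigma {φ : Fml} : IsSigma n φ → Sigma0Sigma n φ
  | not {φ : Fml} : Sigma0Sigma n φ → Sigma0Sigma n (.not φ)
  | and {φ ψ : Fml} : Sigma0Sigma n φ → Sigma0Sigma n ψ → Sigma0Sigma n (.and φ ψ)
  | or {φ ψ : Fml} : Sigma0Sigma n φ → Sigma0Sigma n ψ → Sigma0Sigma n (.or φ ψ)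
  | imp {φ ψ : Fml} : Sigma0Sigma n φ → Sigma0Sigma n ψ → Sigma0Sigma n (.imp φ ψ)
  | ball (x : ℕ) (t : Term) {φ : Fml} : Sigma0Sigma n φ → Sigma0Sigma n (.ball x t φ)
  | bex (x : ℕ) (t : Term) {φ : Fml} : Sigma0Sigma n φ → Sigma0Sigma n (.bex x t φ)

/-- The class `Σₙ ∧ Πₙ` of conjunctions of a `Σₙ` and a `Πₙ` formula. -/
def SigmaAndPi (n : ℕ) (φ : Fml) : Prop :=
  ∃ ψ χ : Fml, IsSigma n ψ ∧ IsPi n χ ∧ φ = Fml.and ψ χ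

/-- The class `Σₙ ∨ Πₙ` of disjunctions of a `Σₙ` and a `Πₙ` formula. -/
def SigmaOrPi (n : ℕ) (φ : Fml) : Prop :=
  ∃ ψ χ : Fml, IsSigma n ψ ∧ IsPi n χ ∧ φ = Fml.or ψ χ

/-- `Δ₀⁰` formulas of second-order arithmetic: only bounded first-order
quantifiers; free set variables (set parameters) are allowed. -/
inductive Delta0SO : Fml → Prop
  | eq (t u : Term) : Delta0SO (.eq t u)
  | lt (t u : Term) : Delta0SO (.lt t u)
  | mem (t : Term) (i : ℕ) : Delta0SO (.mem t i)
  | not {φ : Fml} : Delta0SO φ → Delta0SO (.not φ)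
  | and {φ ψ : Fml} : Delta0SO φ → Delta0SO ψ → Delta0SO (.and φ ψ)
  | or {φ ψ : Fml} : Delta0SO φ → Delta0SO ψ → Delta0SO (.or φ ψ)
  | imp {φ ψ : Fml} : Delta0SO φ → Delta0SO ψ → Delta0SO (.imp φ ψ)
  | ball (x : ℕ) (t : Term) {φ : Fml} : Delta0SO φ → Delta0SO (.ball x t φ)
  | bex (x : ℕ) (t : Term) {φ : Fml} : Delta0SO φ → Delta0SO (.bex x t φ)

mutual
  /-- `Σₙ⁰` formulas of the second-order arithmetic hierarchy
  (set parameters allowed, no set quantifiers). -/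
  inductive SigmaSO : ℕ → Fml → Prop
    | delta0 {n : ℕ} {φ : Fml} : Delta0SO φ → SigmaSO n φ
    | ofPi {n : ℕ} {φ : Fml} : PiSO n φ → SigmaSO (n + 1) φ
    | ex (x : ℕ) {n : ℕ} {φ : Fml} : SigmaSO (n + 1) φ → SigmaSO (n + 1) (.ex x φ)
  /-- `Πₙ⁰` formulas of the second-order arithmetic hierarchy. -/
  inductive PiSO : ℕ → Fml → Prop
    | delta0 {n : ℕ} {φ : Fml} : Delta0SO φ → PiSO n φ
    | ofSigma {n : ℕ} {φ : Fml} : SigmaSO n φ → PiSO (n + 1) φ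
    | all (x : ℕ) {n : ℕ} {φ : Fml} : PiSO (n + 1) φ → PiSO (n + 1) (.all x φ)
end

/-! ## First-order theories -/

/-- `PA⁻`: the theory of non-negative parts of discretely ordered rings. -/
structure PAminus (S : Str) : Prop where
  add_assoc : ∀ a b c, S.add (S.add a b) c = S.add a (S.add b c)
  add_comm : ∀ a b, S.add a b = S.add b a
  mul_assoc : ∀ a b c, S.mul (S.mul a b) c = S.mul a (S.mul b c)
  mul_comm : ∀ a b, S.mul a b = S.mul b a
  distrib : ∀ a b c, S.mul a (S.add b c) = S.add (S.mul a b) (S.mul a c)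
  add_zero : ∀ a, S.add a S.zero = a
  mul_zero : ∀ a, S.mul a S.zero = S.zero
  mul_one : ∀ a, S.mul a S.one = a
  lt_irrefl : ∀ a, ¬ S.lt a a
  lt_trans : ∀ a b c, S.lt a b → S.lt b c → S.lt a c
  lt_total : ∀ a b, S.lt a b ∨ a = b ∨ S.lt b a
  add_lt_add : ∀ a b c, S.lt a b → S.lt (S.add a c) (S.add b c)
  mul_lt_mul : ∀ a b c, S.lt a b → S.lt S.zero c → S.lt (S.mul a c) (S.mul b c)
  zero_lt_one : S.lt S.zero S.one
  zero_le : ∀ a, a = S.zero ∨ S.lt S.zero a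
  discrete : ∀ a b, S.lt a b → S.add a S.one = b ∨ S.lt (S.add a S.one) b
  pred : ∀ a, S.lt S.zero a → ∃ b, S.add b S.one = a
  sub : ∀ a b, S.lt a b → ∃ c, S.add a c = b

/-- The induction scheme for the class `Γ` of formulas
(parameters are allowed via the ambient valuation `v`). -/
def IndFor (S : Str) (Γ : Fml → Prop) : Prop :=
  ∀ φ : Fml, Γ φ → ∀ (v : ℕ → S.M) (x : ℕ),
    Sat0 S (upd v x S.zero) φ →
    (∀ m, Sat0 S (upd v x m) φ → Sat0 S (upd v x (S.add m S.one)) φ) →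
    ∀ m, Sat0 S (upd v x m) φ

/-- The collection scheme for the class `Γ`:
`(∀ x < a ∃ y φ) → (∃ b ∀ x < a ∃ y < b φ)`. -/
def CollFor (S : Str) (Γ : Fml → Prop) : Prop :=
  ∀ φ : Fml, Γ φ → ∀ (v : ℕ → S.M) (x y : ℕ), x ≠ y → ∀ a : S.M,
    (∀ m, S.lt m a → ∃ k, Sat0 S (upd (upd v x m) y k) φ) →
    ∃ b, ∀ m, S.lt m a → ∃ k, S.lt k b ∧ Sat0 S (upd (upd v x m) y k) φ

/-- `IΔ₀` (over `PA⁻`). -/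
def IDelta0 (S : Str) : Prop := PAminus S ∧ IndFor S Delta0

/-- `IΣₙ` (over `PA⁻`; note `Δ₀ ⊆ Σₙ`, so this includes `IΔ₀`). -/
def ISigma (S : Str) (n : ℕ) : Prop := PAminus S ∧ IndFor S (IsSigma n)

/-- `BΣₙ`: the `Σₙ`-collection scheme, including `IΔ₀` (over `PA⁻`). -/
def BSigma (S : Str) (n : ℕ) : Prop := IDelta0 S ∧ CollFor S (IsSigma n)

/-- The weak regularity principle `WRφ` for all `φ` in the class `Γ`:
the universal closure of `(∀ x ∃ y < a φ(x,y)) → (∃ y < a ∀ b ∃ x > b φ(x,y))`.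
Here `x, y` are the two displayed variables and all other free variables of
`φ` are parameters, interpreted by the ambient valuation `v`. -/
def WRFor (S : Str) (Γ : Fml → Prop) : Prop :=
  ∀ φ : Fml, Γ φ → ∀ (v : ℕ → S.M) (x y : ℕ), x ≠ y → ∀ a : S.M,
    (∀ m, ∃ k, S.lt k a ∧ Sat0 S (upd (upd v x m) y k) φ) →
    ∃ k, S.lt k a ∧ ∀ b, ∃ m, S.lt b m ∧ Sat0 S (upd (upd v x m) y k) φ

/-! ## Second-order theories -/

/-- Second-order induction scheme for the class `Γ`, with set parameters
from the second-order universe `X`. -/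
def IndForSO (S : Str) (X : Set (Set S.M)) (Γ : Fml → Prop) : Prop :=
  ∀ φ : Fml, Γ φ → ∀ (v : ℕ → S.M) (w : ℕ → Set S.M), (∀ i, w i ∈ X) → ∀ x : ℕ,
    Sat S X (upd v x S.zero) w φ →
    (∀ m, Sat S X (upd v x m) w φ → Sat S X (upd v x (S.add m S.one)) w φ) →
    ∀ m, Sat S X (upd v x m) w φ

/-- Second-order collection scheme for the class `Γ`. -/
def CollForSO (S : Str) (X : Set (Set S.M)) (Γ : Fml → Prop) : Prop :=
  ∀ φ : Fml, Γ φ → ∀ (v : ℕ → S.M) (w : ℕ → Set S.M), (∀ i, w i ∈ X) →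
    ∀ (x y : ℕ), x ≠ y → ∀ a : S.M,
    (∀ m, S.lt m a → ∃ k, Sat S X (upd (upd v x m) y k) w φ) →
    ∃ b, ∀ m, S.lt m a → ∃ k, S.lt k b ∧ Sat S X (upd (upd v x m) y k) w φ

/-- `Δ₁⁰`-comprehension. -/
def Delta1CA (S : Str) (X : Set (Set S.M)) : Prop :=
  ∀ φ ψ : Fml, SigmaSO 1 φ → PiSO 1 ψ →
    ∀ (v : ℕ → S.M) (w : ℕ → Set S.M), (∀ i, w i ∈ X) → ∀ x : ℕ,
    (∀ m, Sat S X (upd v x m) w φ ↔ Sat S X (upd v x m) w ψ) →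
    ∃ A ∈ X, ∀ m, m ∈ A ↔ Sat S X (upd v x m) w φ

/-- `Σₙ`-comprehension for first-order formulas with parameters from `M`. -/
def SigmaCA (S : Str) (X : Set (Set S.M)) (n : ℕ) : Prop :=
  ∀ φ : Fml, IsSigma n φ → ∀ (v : ℕ → S.M) (x : ℕ),
    ∃ A ∈ X, ∀ m, m ∈ A ↔ Sat0 S (upd v x m) φ

/-- `RCA₀`. -/
def RCA0 (S : Str) (X : Set (Set S.M)) : Prop :=
  PAminus S ∧ IndForSO S X (SigmaSO 1) ∧ Delta1CA S X

/-- `Σ₁⁰`-separation; over `RCA₀` this is equivalent to weak Kőnig's lemma. -/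
def Sigma1Sep (S : Str) (X : Set (Set S.M)) : Prop :=
  ∀ φ ψ : Fml, SigmaSO 1 φ → SigmaSO 1 ψ →
    ∀ (v : ℕ → S.M) (w : ℕ → Set S.M), (∀ i, w i ∈ X) → ∀ x : ℕ,
    (∀ m, ¬ (Sat S X (upd v x m) w φ ∧ Sat S X (upd v x m) w ψ)) →
    ∃ A ∈ X, ∀ m, (Sat S X (upd v x m) w φ → m ∈ A) ∧ (m ∈ A → ¬ Sat S X (upd v x m) w ψ)

/-- `WKL₀`, rendered as `RCA₀` plus `Σ₁⁰`-separation (which is equivalent,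
over `RCA₀`, to weak Kőnig's lemma). -/
def WKL0 (S : Str) (X : Set (Set S.M)) : Prop := RCA0 S X ∧ Sigma1Sep S X

/-- `BΣₙ⁰`: the second-order `Σₙ⁰`-collection scheme (including `IΔ₀⁰`,
over `PA⁻`). -/
def BSigmaSO (S : Str) (X : Set (Set S.M)) (n : ℕ) : Prop :=
  PAminus S ∧ IndForSO S X Delta0SO ∧ CollForSO S X (SigmaSO n)

/-- `IΣₙ⁰`: the second-order `Σₙ⁰`-induction scheme, over `RCA₀`. -/
def ISigmaSO (S : Str) (X : Set (Set S.M)) (n : ℕ) : Prop :=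
  RCA0 S X ∧ IndForSO S X (SigmaSO n)

/-! ## Exponentiation and binary digits -/

/-- Satisfaction of a three-variable formula `E(x₀, x₁, x₂)` at `(a, b, c)`. -/
def ExpAt (S : Str) (E : Fml) (a b c : S.M) : Prop :=
  Sat0 S (fun i => if i = 0 then a else if i = 1 then b else c) E

/-- `E(x₀,x₁,x₂)` is a `Δ₀` definition of the (total) exponentiation function
`x₀ ^ x₁ = x₂`.  The existence of such an `E` expresses `exp`
(the totality of exponentiation). -/
structure IsExpDef (S : Str) (E : Fml) : Prop where
  delta0 : Delta0 E
  base : ∀ a, ExpAt S E a S.zero S.one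
  total : ∀ a b, ∃ c, ExpAt S E a b c
  unique : ∀ a b c c', ExpAt S E a b c → ExpAt S E a b c' → c = c'
  step : ∀ a b c, ExpAt S E a b c → ExpAt S E a (S.add b S.one) (S.mul c a)

/-- `exp`: the totality of exponentiation (via a `Δ₀` definition of its
graph). -/
def SatExp (S : Str) : Prop := ∃ E : Fml, IsExpDef S E

/-! ## Embeddings, end extensions and elementarity -/

/-- An embedding of arithmetic structures. -/
structure Emb (S K : Str) where
  j : S.M → K.M
  inj : Function.Injective j
  zero : j S.zero = K.zero
  one : j S.one = K.one
  add : ∀ a b, j (S.add a b) = K.add (j a) (j b)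
  mul : ∀ a b, j (S.mul a b) = K.mul (j a) (j b)
  lt_iff : ∀ a b, S.lt a b ↔ K.lt (j a) (j b)

/-- The extension along `e` is an end extension: every element of `K` not in
the image of `M` exceeds every element of `M`. -/
def IsEndExt {S K : Str} (e : Emb S K) : Prop :=
  ∀ b : K.M, b ∉ Set.range e.j → ∀ a : S.M, K.lt (e.j a) b

/-- The extension along `e` is proper. -/
def IsProper {S K : Str} (e : Emb S K) : Prop := ¬ Function.Surjective e.j

/-- The extension along `e` is `Σₙ`-elementary: all `Σₙ` formulas with
parameters from `M` are absolute between `M` and `K`. -/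
def SigmaElem {S K : Str} (e : Emb S K) (n : ℕ) : Prop :=
  ∀ φ : Fml, IsSigma n φ → ∀ v : ℕ → S.M,
    (Sat0 S v φ ↔ Sat0 K (fun i => e.j (v i)) φ)

/-- `K ⊨ M‑IΣₙ` (for an extension `e : M → K`): induction up to any `a ∈ M`
for `Σₙ` formulas with parameters from `K`. -/
def MISigma {S K : Str} (e : Emb S K) (n : ℕ) : Prop :=
  ∀ φ : Fml, IsSigma n φ → ∀ (v : ℕ → K.M) (x : ℕ) (a : S.M),
    Sat0 K (upd v x K.zero) φ →
    (∀ m, K.lt m (e.j a) → (Sat0 K (upd v x m) φ → Sat0 K (upd v x (K.add m K.one)) φ)) →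
    ∀ m, K.lt m (e.j a) → Sat0 K (upd v x m) φ

/-- The `x`-th binary digit of `c ∈ K` is `1`, computed via a `Δ₀` definition
`E` of exponentiation on the ground model `S` (here `x` lies under the image
of `S`): there are `x', p ∈ M` with `j x' = x`, `p = 2 ^ x'`, and `u, v ∈ K`
with `c = u·(2p) + p + v` and `v < p`. -/
def BitVia {S K : Str} (e : Emb S K) (E : Fml) (x c : K.M) : Prop :=
  ∃ x' p : S.M, e.j x' = x ∧ ExpAt S E (S.add S.one S.one) x' p ∧
    ∃ u v : K.M, K.lt v (e.j p) ∧
      c = K.add (K.add (K.mul u (K.add (e.j p) (e.j p))) (e.j p)) v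

/-! ## The second-order restricted ultrapower -/

/-- `A` is cofinal (unbounded) in `S`. -/
def Cofinal (S : Str) (A : Set S.M) : Prop := ∀ b : S.M, ∃ x ∈ A, S.lt b x

/-- The pairing term `⟨x, y⟩ = (x + y)·(x + y) + x`. -/
def pairS (S : Str) (x y : S.M) : S.M := S.add (S.mul (S.add x y) (S.add x y)) x

/-- The graph of `f : M → M`, coded as a subset of `M` via pairing. -/
def graphOf (S : Str) (f : S.M → S.M) : Set S.M := {m | ∃ x, m = pairS S x (f x)}

/-- `f` is a total function `M → M` lying in the second-order universe `X`
(its coded graph belongs to `X`).  The collection of such `f` is the class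
`ℱ` of the restricted ultrapower. -/
def FuncIn (S : Str) (X : Set (Set S.M)) (f : S.M → S.M) : Prop := graphOf S f ∈ X

/-- `U` is an ultrafilter on the Boolean algebra `X`, all of whose elements
are cofinal in `M`. -/
structure UltraOn (S : Str) (X U : Set (Set S.M)) : Prop where
  subset : U ⊆ X
  univ_mem : Set.univ ∈ U
  empty_not_mem : ∅ ∉ U
  inter_mem : ∀ A ∈ U, ∀ B ∈ U, A ∩ B ∈ U
  superset_mem : ∀ A ∈ U, ∀ B ∈ X, A ⊆ B → B ∈ U
  ultra : ∀ A ∈ X, A ∈ U ∨ Aᶜ ∈ U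
  cofinal : ∀ A ∈ U, Cofinal S A

/-- A realization of the second-order restricted ultrapower `ℱ/𝒰` of `S`
with respect to the second-order universe `X` and the ultrafilter `U`:
a structure `K` whose elements are exactly the classes `cls f hf = [f]` of
total functions `f ∈ ℱ`, where `[f] = [g]` iff `f = g` on a set in `U`, with
pointwise arithmetic operations, order decided by `U`, and the inherited
second-order membership relation `memK` serving as the second-order expansion. -/
structure RUP (S : Str) (X U : Set (Set S.M)) : Type 1 where
  K : Str
  cls : (f : S.M → S.M) → FuncIn S X f → K.M
  memK : K.M → Set S.M → Prop
  const_in : ∀ a : S.M, FuncIn S X (fun _ => a)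
  surj : ∀ b : K.M, ∃ (f : S.M → S.M) (hf : FuncIn S X f), cls f hf = b
  eq_iff : ∀ (f : S.M → S.M) (hf : FuncIn S X f) (g : S.M → S.M) (hg : FuncIn S X g),
      (cls f hf = cls g hg) ↔ {i : S.M | f i = g i} ∈ U
  lt_iff : ∀ (f : S.M → S.M) (hf : FuncIn S X f) (g : S.M → S.M) (hg : FuncIn S X g),
      K.lt (cls f hf) (cls g hg) ↔ {i : S.M | S.lt (f i) (g i)} ∈ U
  zero_eq : K.zero = cls (fun _ => S.zero) (const_in S.zero)
  one_eq : K.one = cls (fun _ => S.one) (const_in S.one)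
  add_eq : ∀ (f : S.M → S.M) (hf : FuncIn S X f) (g : S.M → S.M) (hg : FuncIn S X g)
      (h : S.M → S.M) (hh : FuncIn S X h), (∀ i, h i = S.add (f i) (g i)) →
      K.add (cls f hf) (cls g hg) = cls h hh
  mul_eq : ∀ (f : S.M → S.M) (hf : FuncIn S X f) (g : S.M → S.M) (hg : FuncIn S X g)
      (h : S.M → S.M) (hh : FuncIn S X h), (∀ i, h i = S.mul (f i) (g i)) →
      K.mul (cls f hf) (cls g hg) = cls h hh
  mem_iff : ∀ (f : S.M → S.M) (hf : FuncIn S X f) (A : Set S.M), A ∈ X →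
      (memK (cls f hf) A ↔ {i : S.M | f i ∈ A} ∈ U)

/-- The canonical embedding `M → ℱ/𝒰` via constant functions. -/
def RUP.emb {S : Str} {X U : Set (Set S.M)} (R : RUP S X U) (a : S.M) : R.K.M :=
  R.cls (fun _ => a) (R.const_in a)

/-- The subset of `ℱ/𝒰` induced by `A ⊆ M`. -/
def RUP.setImg {S : Str} {X U : Set (Set S.M)} (R : RUP S X U) (A : Set S.M) :
    Set R.K.M := {b | R.memK b A}

/-- The second-order part of the expanded ultrapower `(ℱ/𝒰, 𝒳)`:
the (injected) copy of `X`. -/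
def RUP.X2 {S : Str} {X U : Set (Set S.M)} (R : RUP S X U) : Set (Set R.K.M) :=
  (fun A => R.setImg A) '' X

end PaperArith

namespace PaperArith


/-! ## Renaming of number variables -/

/-- Renaming of the variables of a term. -/
def Term.rename (σ : ℕ → ℕ) : Term → Term
  | .var i => .var (σ i)
  | .zero => .zero
  | .one => .one
  | .add t u => .add (t.rename σ) (u.rename σ)
  | .mul t u => .mul (t.rename σ) (u.rename σ)

/-- Capture-avoiding renaming of the free number variables of a formula; the bound variables
are renamed to `N`, `N + 1`, …, where `N` bounds the range of `σ`. -/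
def Fml.rename : (ℕ → ℕ) → ℕ → Fml → Fml
  | σ, _, .eq t u => .eq (t.rename σ) (u.rename σ)
  | σ, _, .lt t u => .lt (t.rename σ) (u.rename σ)
  | σ, _, .mem t i => .mem (t.rename σ) i
  | σ, N, .not φ => .not (φ.rename σ N)
  | σ, N, .and φ ψ => .and (φ.rename σ N) (ψ.rename σ N)
  | σ, N, .or φ ψ => .or (φ.rename σ N) (ψ.rename σ N)
  | σ, N, .imp φ ψ => .imp (φ.rename σ N) (ψ.rename σ N)
  | σ, N, .all x φ => .all N (φ.rename (upd σ x N) (N + 1))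
  | σ, N, .ex x φ => .ex N (φ.rename (upd σ x N) (N + 1))
  | σ, N, .ball x t φ => .ball N (t.rename σ) (φ.rename (upd σ x N) (N + 1))
  | σ, N, .bex x t φ => .bex N (t.rename σ) (φ.rename (upd σ x N) (N + 1))
  | σ, N, .sall i φ => .sall i (φ.rename σ N)
  | σ, N, .sex i φ => .sex i (φ.rename σ N)

theorem tval_rename (S : Str) (v : ℕ → S.M) (σ : ℕ → ℕ) (t : Term) :
    tval S v (t.rename σ) = tval S (fun i => v (σ i)) t := by
  induction t with
  | var i => rfl
  | zero => rfl
  | one => rfl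
  | add t u iht ihu => simp [Term.rename, tval, iht, ihu]
  | mul t u iht ihu => simp [Term.rename, tval, iht, ihu]

theorem upd_comp_upd {α : Type} {σ : ℕ → ℕ} {N : ℕ} (hσ : ∀ i, σ i < N) (v : ℕ → α) (x : ℕ)
    (m : α) : (fun i => upd v N m (upd σ x N i)) = upd (fun i => v (σ i)) x m := by
  funext i
  by_cases h : i = x
  · simp [upd, h]
  · simp [upd, h, (hσ i).ne]

theorem upd_lt_succ {σ : ℕ → ℕ} {N : ℕ} (hσ : ∀ i, σ i < N) (x i : ℕ) :
    upd σ x N i < N + 1 := by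
  unfold upd
  split_ifs
  · omega
  · exact (hσ i).trans (Nat.lt_succ_self N)

theorem sat_rename (S : Str) (X : Set (Set S.M)) (φ : Fml) :
    ∀ (σ : ℕ → ℕ) (N : ℕ) (v : ℕ → S.M) (w : ℕ → Set S.M), (∀ i, σ i < N) →
      (Sat S X v w (φ.rename σ N) ↔ Sat S X (fun i => v (σ i)) w φ) := by
  induction φ with
  | eq t u => intros; simp [Fml.rename, Sat, tval_rename]
  | lt t u => intros; simp [Fml.rename, Sat, tval_rename]
  | mem t i => intros; simp [Fml.rename, Sat, tval_rename]
  | not φ ih => intro σ N v w h; simp [Fml.rename, Sat, ih σ N v w h]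
  | and φ ψ ih ih' => intro σ N v w h; simp [Fml.rename, Sat, ih σ N v w h, ih' σ N v w h]
  | or φ ψ ih ih' => intro σ N v w h; simp [Fml.rename, Sat, ih σ N v w h, ih' σ N v w h]
  | imp φ ψ ih ih' => intro σ N v w h; simp [Fml.rename, Sat, ih σ N v w h, ih' σ N v w h]
  | all x φ ih =>
    intro σ N v w h
    simp [Fml.rename, Sat, ih _ _ _ w (upd_lt_succ h x), upd_comp_upd h]
  | ex x φ ih =>
    intro σ N v w h
    simp [Fml.rename, Sat, ih _ _ _ w (upd_lt_succ h x), upd_comp_upd h]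
  | ball x t φ ih =>
    intro σ N v w h
    simp [Fml.rename, Sat, tval_rename, ih _ _ _ w (upd_lt_succ h x), upd_comp_upd h]
  | bex x t φ ih =>
    intro σ N v w h
    simp [Fml.rename, Sat, tval_rename, ih _ _ _ w (upd_lt_succ h x), upd_comp_upd h]
  | sall i φ ih => intro σ N v w h; simp [Fml.rename, Sat, ih σ N v _ h]
  | sex i φ ih => intro σ N v w h; simp [Fml.rename, Sat, ih σ N v _ h]

theorem exists_tval_congr (S : Str) (t : Term) :
    ∃ K : ℕ, ∀ v v' : ℕ → S.M, (∀ i < K, v i = v' i) → tval S v t = tval S v' t := by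
  induction t with
  | var i => exact ⟨i + 1, fun v v' h => h i (Nat.lt_succ_self i)⟩
  | zero => exact ⟨0, fun _ _ _ => rfl⟩
  | one => exact ⟨0, fun _ _ _ => rfl⟩
  | add t u iht ihu =>
    obtain ⟨K, hK⟩ := iht
    obtain ⟨L, hL⟩ := ihu
    refine ⟨max K L, fun v v' h => ?_⟩
    rw [tval, tval, hK v v' fun i hi => h i (by omega), hL v v' fun i hi => h i (by omega)]
  | mul t u iht ihu =>
    obtain ⟨K, hK⟩ := iht
    obtain ⟨L, hL⟩ := ihu
    refine ⟨max K L, fun v v' h => ?_⟩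
    rw [tval, tval, hK v v' fun i hi => h i (by omega), hL v v' fun i hi => h i (by omega)]

theorem upd_congr {α : Type} {K : ℕ} {v v' : ℕ → α} (h : ∀ i < K, v i = v' i) (x : ℕ) (m : α) :
    ∀ i < K, upd v x m i = upd v' x m i := by
  intro i hi
  simp [upd, h i hi]

theorem exists_sat_congr (S : Str) (X : Set (Set S.M)) (φ : Fml) :
    ∃ K : ℕ, ∀ (v v' : ℕ → S.M) (w : ℕ → Set S.M), (∀ i < K, v i = v' i) →
      (Sat S X v w φ ↔ Sat S X v' w φ) := by
  induction φ with
  | eq t u | lt t u =>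
    obtain ⟨K, hK⟩ := exists_tval_congr S t
    obtain ⟨L, hL⟩ := exists_tval_congr S u
    refine ⟨max K L, fun v v' w h => ?_⟩
    rw [Sat, Sat, hK v v' fun i hi => h i (by omega), hL v v' fun i hi => h i (by omega)]
  | mem t i =>
    obtain ⟨K, hK⟩ := exists_tval_congr S t
    refine ⟨K, fun v v' w h => ?_⟩
    rw [Sat, Sat, hK v v' h]
  | not φ ih =>
    obtain ⟨K, hK⟩ := ih
    refine ⟨K, fun v v' w h => ?_⟩
    rw [Sat, Sat, hK v v' w h]
  | and φ ψ ih ih' | or φ ψ ih ih' | imp φ ψ ih ih' =>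
    obtain ⟨K, hK⟩ := ih
    obtain ⟨L, hL⟩ := ih'
    refine ⟨max K L, fun v v' w h => ?_⟩
    rw [Sat, Sat, hK v v' w fun i hi => h i (by omega), hL v v' w fun i hi => h i (by omega)]
  | all x φ ih | ex x φ ih =>
    obtain ⟨K, hK⟩ := ih
    refine ⟨K, fun v v' w h => ?_⟩
    simp only [Sat, fun m => hK _ _ w (upd_congr h x m)]
  | ball x t φ ih | bex x t φ ih =>
    obtain ⟨K, hK⟩ := ih
    obtain ⟨L, hL⟩ := exists_tval_congr S t
    refine ⟨max K L, fun v v' w h => ?_⟩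
    have h' : ∀ i < K, v i = v' i := fun i hi => h i (by omega)
    simp only [Sat, fun m => hK _ _ w (upd_congr h' x m), hL v v' fun i hi => h i (by omega)]
  | sall i φ ih | sex i φ ih =>
    obtain ⟨K, hK⟩ := ih
    refine ⟨K, fun v v' w h => ?_⟩
    simp only [Sat, fun A => hK v v' (upd w i A) h]

theorem Delta0.rename {φ : Fml} (h : Delta0 φ) : ∀ σ N, Delta0 (φ.rename σ N) := by
  induction h with
  | eq => intros; exact .eq _ _
  | lt => intros; exact .lt _ _
  | not _ ih => intro σ N; exact .not (ih σ N)
  | and _ _ ih ih' => intro σ N; exact .and (ih σ N) (ih' σ N)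
  | or _ _ ih ih' => intro σ N; exact .or (ih σ N) (ih' σ N)
  | imp _ _ ih ih' => intro σ N; exact .imp (ih σ N) (ih' σ N)
  | ball x t _ ih => intro σ N; exact .ball _ _ (ih _ _)
  | bex x t _ ih => intro σ N; exact .bex _ _ (ih _ _)

mutual
theorem IsSigma.rename : ∀ {n : ℕ} {φ : Fml}, IsSigma n φ → ∀ σ N, IsSigma n (φ.rename σ N)
  | _, _, .delta0 h, σ, N => .delta0 (h.rename σ N)
  | _, _, .ofPi h, σ, N => .ofPi (h.rename σ N)
  | _, _, .ex _ h, _, _ => .ex _ (h.rename _ _)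
theorem IsPi.rename : ∀ {n : ℕ} {φ : Fml}, IsPi n φ → ∀ σ N, IsPi n (φ.rename σ N)
  | _, _, .delta0 h, σ, N => .delta0 (h.rename σ N)
  | _, _, .ofSigma h, σ, N => .ofSigma (h.rename σ N)
  | _, _, .all _ h, _, _ => .all _ (h.rename _ _)
end

theorem Sigma0Sigma.rename {n : ℕ} {φ : Fml} (h : Sigma0Sigma n φ) :
    ∀ σ N, Sigma0Sigma n (φ.rename σ N) := by
  induction h with
  | ofSigma h => intro σ N; exact .ofSigma (h.rename σ N)
  | not _ ih => intro σ N; exact .not (ih σ N)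
  | and _ _ ih ih' => intro σ N; exact .and (ih σ N) (ih' σ N)
  | or _ _ ih ih' => intro σ N; exact .or (ih σ N) (ih' σ N)
  | imp _ _ ih ih' => intro σ N; exact .imp (ih σ N) (ih' σ N)
  | ball x t _ ih => intro σ N; exact .ball _ _ (ih _ _)
  | bex x t _ ih => intro σ N; exact .bex _ _ (ih _ _)

/-- `Σ₀(Σₙ)` is closed under arbitrary renamings of variables, up to equivalence in `S`. -/
theorem Sigma0Sigma.exists_rename (S : Str) {n : ℕ} {φ : Fml} (h : Sigma0Sigma n φ)
    (σ : ℕ → ℕ) :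
    ∃ ψ, Sigma0Sigma n ψ ∧ ∀ v : ℕ → S.M, Sat0 S v ψ ↔ Sat0 S (fun i => v (σ i)) φ := by
  obtain ⟨K, hK⟩ := exists_sat_congr S ∅ φ
  obtain ⟨N, hN⟩ : ∃ N, ∀ i < K, σ i < N :=
    ⟨(Finset.range K).sup σ + 1, fun i hi =>
      Nat.lt_succ_of_le (Finset.le_sup (f := σ) (Finset.mem_range.2 hi))⟩
  have hτ : ∀ i, (fun i => if i < K then σ i else 0) i < N + 1 := by
    intro i
    by_cases hi : i < K
    · simpa [hi] using (hN i hi).trans (Nat.lt_succ_self N)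
    · simp [hi]
  refine ⟨_, h.rename (fun i => if i < K then σ i else 0) (N + 1), fun v => ?_⟩
  rw [Sat0, sat_rename S ∅ φ _ _ v _ hτ]
  exact hK _ _ _ fun i hi => by simp [hi]

/-! ## Relations between the formula classes -/

mutual
theorem IsSigma.succ : ∀ {n : ℕ} {φ : Fml}, IsSigma n φ → IsSigma (n + 1) φ
  | _, _, .delta0 h => .delta0 h
  | _, _, .ofPi h => .ofPi h.succ
  | _, _, .ex x h => .ex x h.succ
theorem IsPi.succ : ∀ {n : ℕ} {φ : Fml}, IsPi n φ → IsPi (n + 1) φ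
  | _, _, .delta0 h => .delta0 h
  | _, _, .ofSigma h => .ofSigma h.succ
  | _, _, .all x h => .all x h.succ
end

theorem Sigma0Sigma.succ {n : ℕ} {φ : Fml} (h : Sigma0Sigma n φ) : Sigma0Sigma (n + 1) φ := by
  induction h with
  | ofSigma h => exact .ofSigma h.succ
  | not _ ih => exact .not ih
  | and _ _ ih ih' => exact .and ih ih'
  | or _ _ ih ih' => exact .or ih ih'
  | imp _ _ ih ih' => exact .imp ih ih'
  | ball x t _ ih => exact .ball _ _ ih
  | bex x t _ ih => exact .bex _ _ ih

theorem Sigma0Sigma.delta0 {φ : Fml} (h : Sigma0Sigma 0 φ) : Delta0 φ := by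
  induction h with
  | ofSigma h => cases h; assumption
  | not _ ih => exact .not ih
  | and _ _ ih ih' => exact .and ih ih'
  | or _ _ ih ih' => exact .or ih ih'
  | imp _ _ ih ih' => exact .imp ih ih'
  | ball x t _ ih => exact .ball _ _ ih
  | bex x t _ ih => exact .bex _ _ ih

mutual
theorem IsSigma.exists_dual (S : Str) : ∀ {n : ℕ} {φ : Fml}, IsSigma n φ →
    ∃ ψ, IsPi n ψ ∧ ∀ v : ℕ → S.M, Sat0 S v ψ ↔ ¬ Sat0 S v φ
  | _, _, .delta0 h => ⟨_, .delta0 h.not, fun _ => Iff.rfl⟩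
  | _, _, .ofPi h =>
    let ⟨ψ, hψ, e⟩ := h.exists_dual S
    ⟨ψ, .ofSigma hψ, e⟩
  | _, _, .ex x h =>
    let ⟨ψ, hψ, e⟩ := h.exists_dual S
    ⟨.all x ψ, .all x hψ, fun v => (forall_congr' fun m => e (upd v x m)).trans not_exists.symm⟩
theorem IsPi.exists_dual (S : Str) : ∀ {n : ℕ} {φ : Fml}, IsPi n φ →
    ∃ ψ, IsSigma n ψ ∧ ∀ v : ℕ → S.M, Sat0 S v ψ ↔ ¬ Sat0 S v φ
  | _, _, .delta0 h => ⟨_, .delta0 h.not, fun _ => Iff.rfl⟩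
  | _, _, .ofSigma h =>
    let ⟨ψ, hψ, e⟩ := h.exists_dual S
    ⟨ψ, .ofPi hψ, e⟩
  | _, _, .all x h =>
    let ⟨ψ, hψ, e⟩ := h.exists_dual S
    ⟨.ex x ψ, .ex x hψ, fun v => (exists_congr fun m => e (upd v x m)).trans not_forall.symm⟩
end

/-! ## Definable relations on iterated products -/

/-- A context is a type of finite tuples of elements of `S`, together with its coordinate
functions and the constant functions. -/
class Ctx (S : Str) (α : Type) where
  coords : Set (α → S.M)
  const_mem : ∀ m, (fun _ => m) ∈ coords

instance Ctx.unit (S : Str) : Ctx S Unit := ⟨Set.univ, fun _ => Set.mem_univ _⟩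

instance Ctx.prod (S : Str) (α : Type) [Ctx S α] : Ctx S (α × S.M) :=
  ⟨{f | f = Prod.snd ∨ ∃ c ∈ Ctx.coords (S := S) (α := α), f = fun p => c p.1},
    fun m => Or.inr ⟨_, Ctx.const_mem m, rfl⟩⟩

/-- `c` is a coordinate function or a constant. -/
def IsCoord (S : Str) {α : Type} [Ctx S α] (c : α → S.M) : Prop :=
  c ∈ Ctx.coords (S := S) (α := α)

/-- `g` is the value of a term in the coordinates. -/
def IsTerm (S : Str) {α : Type} [Ctx S α] (g : α → S.M) : Prop :=
  ∃ (t : Term) (e : ℕ → α → S.M), (∀ i, IsCoord S (e i)) ∧ ∀ a, g a = tval S (fun i => e i a) t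

/-- `P` is defined by a `Σ₀(Σₙ)` formula with parameters. -/
def Dfn (S : Str) (n : ℕ) {α : Type} [Ctx S α] (P : α → Prop) : Prop :=
  ∃ φ, Sigma0Sigma n φ ∧ ∃ e : ℕ → α → S.M, (∀ i, IsCoord S (e i)) ∧
    ∀ a, P a ↔ Sat0 S (fun i => e i a) φ

/-- A map of contexts all of whose components are coordinates or constants. -/
def CtxMap (S : Str) {α β : Type} [Ctx S α] [Ctx S β] (g : β → α) : Prop :=
  ∀ c, IsCoord S c → IsCoord S fun b => c (g b)

section Contexts

variable {S : Str} {n : ℕ} {α β : Type} [Ctx S α] [Ctx S β]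

theorem IsCoord.const (m : S.M) : IsCoord S fun _ : α => m := Ctx.const_mem m

theorem IsCoord.snd : IsCoord S fun p : α × S.M => p.2 := Or.inl rfl

theorem IsCoord.fst {c : α → S.M} (h : IsCoord S c) : IsCoord S fun p : α × S.M => c p.1 :=
  Or.inr ⟨c, h, rfl⟩

theorem CtxMap.id : CtxMap S fun a : α => a := fun _ h => h

theorem CtxMap.fst {g : β → α} (h : CtxMap S g) : CtxMap S fun p : β × S.M => g p.1 :=
  fun c hc => (h c hc).fst

theorem CtxMap.const (a : α) : CtxMap S fun _ : β => a := fun c _ => IsCoord.const (c a)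

theorem CtxMap.pair {g : β → α} {c : β → S.M} (h : CtxMap S g) (hc : IsCoord S c) :
    CtxMap S fun b => (g b, c b) := by
  rintro d (rfl | ⟨d, hd, rfl⟩)
  · exact hc
  · exact h d hd

theorem IsCoord.isTerm {c : α → S.M} (h : IsCoord S c) : IsTerm S c :=
  ⟨.var 0, fun _ => c, fun _ => h, fun _ => rfl⟩

theorem IsTerm.fst {g : α → S.M} (h : IsTerm S g) : IsTerm S fun p : α × S.M => g p.1 := by
  obtain ⟨t, e, he, hg⟩ := h
  exact ⟨t, fun i p => e i p.1, fun i => (he i).fst, fun p => hg p.1⟩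

theorem Dfn.congr {P Q : α → Prop} (h : Dfn S n P) (e : ∀ a, Q a ↔ P a) : Dfn S n Q :=
  (funext fun a => propext (e a) : Q = P) ▸ h

theorem Dfn.comp {P : α → Prop} (h : Dfn S n P) {g : β → α} (hg : CtxMap S g) :
    Dfn S n fun b => P (g b) := by
  obtain ⟨φ, hφ, e, he, hP⟩ := h
  exact ⟨φ, hφ, fun i b => e i (g b), fun i => hg _ (he i), fun b => hP (g b)⟩

theorem Dfn.lt {c d : α → S.M} (hc : IsCoord S c) (hd : IsCoord S d) :
    Dfn S n fun a => S.lt (c a) (d a) := by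
  refine ⟨.lt (.var 0) (.var 1), .ofSigma (.delta0 (.lt _ _)), fun i => if i = 0 then c else d,
    fun i => ?_, fun a => ?_⟩
  · dsimp only
    split_ifs <;> assumption
  · simp [Sat0, Sat, tval]

theorem Dfn.not {P : α → Prop} (h : Dfn S n P) : Dfn S n fun a => ¬ P a := by
  obtain ⟨φ, hφ, e, he, hP⟩ := h
  exact ⟨.not φ, .not hφ, e, he, fun a => not_congr (hP a)⟩

theorem Dfn.and {P Q : α → Prop} (h : Dfn S n P) (h' : Dfn S n Q) :
    Dfn S n fun a => P a ∧ Q a := by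
  obtain ⟨φ, hφ, e, he, hP⟩ := h
  obtain ⟨ψ, hψ, f, hf, hQ⟩ := h'
  let k := Equiv.natSumNatEquivNat
  obtain ⟨φ', hφ', eφ⟩ := hφ.exists_rename S fun i => k (.inl i)
  obtain ⟨ψ', hψ', eψ⟩ := hψ.exists_rename S fun i => k (.inr i)
  refine ⟨.and φ' ψ', .and hφ' hψ', fun i => Sum.elim e f (k.symm i), fun i => ?_, fun a => ?_⟩
  · change IsCoord S (Sum.elim e f (k.symm i))
    rcases k.symm i with j | j
    · exact he j
    · exact hf j
  · change _ ↔ Sat0 S _ φ' ∧ Sat0 S _ ψ'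
    rw [eφ, eψ]
    simpa using and_congr (hP a) (hQ a)

theorem Dfn.or {P Q : α → Prop} (h : Dfn S n P) (h' : Dfn S n Q) :
    Dfn S n fun a => P a ∨ Q a :=
  (h.not.and h'.not).not.congr fun a => by tauto

theorem Dfn.imp {P Q : α → Prop} (h : Dfn S n P) (h' : Dfn S n Q) :
    Dfn S n fun a => P a → Q a :=
  (h.and h'.not).not.congr fun a => by tauto

/-- The last coordinate of a definable relation can be read from the variable `0`. -/
theorem Dfn.exists_var_zero {P : α × S.M → Prop} (h : Dfn S n P) :
    ∃ φ, Sigma0Sigma n φ ∧ ∃ e : ℕ → α → S.M, (∀ i, IsCoord S (e i)) ∧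
      ∀ a m, P (a, m) ↔ Sat0 S (upd (fun i => e i a) 0 m) φ := by
  obtain ⟨φ, hφ, e, he, hP⟩ := h
  have key : ∀ i, ∃ (j : ℕ) (c : α → S.M), IsCoord S c ∧ ∀ a m,
      e i (a, m) = if j = 0 then m else c a := by
    intro i
    rcases he i with h | ⟨c, hc, h⟩
    · exact ⟨0, fun _ => S.zero, IsCoord.const _, fun a m => by simp [h]⟩
    · exact ⟨1, c, hc, fun a m => by simp [h]⟩
  choose j c hc hj using key
  obtain ⟨ψ, hψ, eψ⟩ := hφ.exists_rename S fun i => if j i = 0 then 0 else i + 1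
  refine ⟨ψ, hψ, fun i => c (i - 1), fun i => hc _, fun a m => ?_⟩
  rw [hP, eψ]
  refine iff_of_eq (congrArg (fun v => Sat0 S v φ) (funext fun i => ?_))
  rw [hj]
  by_cases h0 : j i = 0 <;> simp [h0, upd]

theorem Dfn.bex {P : α × S.M → Prop} (h : Dfn S n P) {g : α → S.M} (hg : IsTerm S g) :
    Dfn S n fun a => ∃ x, S.lt x (g a) ∧ P (a, x) := by
  obtain ⟨φ, hφ, e, he, hP⟩ := h.exists_var_zero
  obtain ⟨t, f, hf, hg⟩ := hg
  let k := Equiv.natSumNatEquivNat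
  obtain ⟨φ', hφ', eφ⟩ := hφ.exists_rename S fun i => k (.inl i)
  refine ⟨.bex (k (.inl 0)) (t.rename fun i => k (.inr i)) φ', .bex _ _ hφ',
    fun i => Sum.elim e f (k.symm i), fun i => ?_, fun a => ?_⟩
  · change IsCoord S (Sum.elim e f (k.symm i))
    rcases k.symm i with j | j
    · exact he j
    · exact hf j
  · refine exists_congr fun m => and_congr ?_ ?_
    · rw [tval_rename, hg]
      simp
    · change _ ↔ Sat0 S _ φ'
      rw [eφ, hP]
      refine iff_of_eq (congrArg (fun v => Sat0 S v φ) (funext fun i => ?_))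
      simp [upd]

theorem Dfn.ball {P : α × S.M → Prop} (h : Dfn S n P) {g : α → S.M} (hg : IsTerm S g) :
    Dfn S n fun a => ∀ x, S.lt x (g a) → P (a, x) :=
  (h.not.bex hg).not.congr fun a => by simp

theorem Dfn.exists_formula_one {P : Unit × S.M → Prop} (h : Dfn S n P) :
    ∃ φ, Sigma0Sigma n φ ∧ ∃ v : ℕ → S.M, ∀ m, P ((), m) ↔ Sat0 S (upd v 0 m) φ := by
  obtain ⟨φ, hφ, e, -, hP⟩ := h.exists_var_zero
  exact ⟨φ, hφ, fun i => e i (), fun m => hP () m⟩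

theorem Dfn.exists_formula_two {P : (Unit × S.M) × S.M → Prop} (h : Dfn S n P) :
    ∃ φ, Sigma0Sigma n φ ∧ ∃ v : ℕ → S.M, ∀ m k,
      P (((), m), k) ↔ Sat0 S (upd (upd v 1 m) 0 k) φ := by
  obtain ⟨φ, hφ, e, he, hP⟩ := h.exists_var_zero
  have key : ∀ i, ∃ (j : ℕ) (c : S.M), ∀ m, e i ((), m) = if j = 0 then m else c := by
    intro i
    rcases he i with h | ⟨c, hc, h⟩
    · exact ⟨0, S.zero, fun m => by simp [h]⟩
    · exact ⟨1, c (), fun m => by simp [h]⟩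
  choose j c hj using key
  obtain ⟨ψ, hψ, eψ⟩ := hφ.exists_rename S fun i =>
    if i = 0 then 0 else if j i = 0 then 1 else i + 2
  refine ⟨ψ, hψ, fun i => c (i - 2), fun m k => ?_⟩
  rw [hP, eψ]
  refine iff_of_eq (congrArg (fun v => Sat0 S v φ) (funext fun i => ?_))
  by_cases hi : i = 0
  · simp [hi, upd]
  · by_cases h0 : j i = 0 <;> simp [hi, h0, upd, hj]

end Contexts

/-! ## Order -/

theorem PAminus.lt_succ {S : Str} (h : PAminus S) (a : S.M) : S.lt a (S.add a S.one) := by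
  have := h.add_lt_add _ _ a h.zero_lt_one
  rwa [h.add_comm, h.add_zero, h.add_comm] at this

theorem PAminus.exists_gt₂ {S : Str} (h : PAminus S) (a b : S.M) :
    ∃ c, S.lt a c ∧ S.lt b c := by
  rcases h.lt_total a b with hab | rfl | hab
  · exact ⟨_, h.lt_trans _ _ _ hab (h.lt_succ b), h.lt_succ b⟩
  · exact ⟨_, h.lt_succ a, h.lt_succ a⟩
  · exact ⟨_, h.lt_succ a, h.lt_trans _ _ _ hab (h.lt_succ a)⟩

theorem PAminus.not_lt_zero {S : Str} (h : PAminus S) (a : S.M) : ¬ S.lt a S.zero := by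
  intro ha
  rcases h.zero_le a with rfl | h0
  · exact h.lt_irrefl _ ha
  · exact h.lt_irrefl _ (h.lt_trans _ _ _ ha h0)

/-! ## Monotone `Σ₂`-like relations over `Σ₀(Σₙ)` -/

/-- A relation `A(a, w, s)` that is increasing in `w` and decreasing in `s`. -/
structure MonoRel (S : Str) (n : ℕ) {α : Type} [Ctx S α] (A : (α × S.M) × S.M → Prop) :
    Prop where
  dfn : Dfn S n A
  mono : ∀ {a w w' s}, S.lt w w' → A ((a, w), s) → A ((a, w'), s)
  anti : ∀ {a w s s'}, S.lt s' s → A ((a, w), s) → A ((a, w), s')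

/-- `P` has the form `∃ w, ∀ s, A(·, w, s)` with `A` monotone and definable by `Σ₀(Σₙ)`. -/
def ExAll (S : Str) (n : ℕ) {α : Type} [Ctx S α] (P : α → Prop) : Prop :=
  ∃ A, MonoRel S n A ∧ ∀ a, P a ↔ ∃ w, ∀ s, A ((a, w), s)

/-- `P` has the form `∃ w, A(·, w)` with `A` increasing in `w` and definable by `Σ₀(Σₙ)`. -/
def ExDfn (S : Str) (n : ℕ) {α : Type} [Ctx S α] (P : α → Prop) : Prop :=
  ∃ A : α × S.M → Prop, Dfn S n A ∧ (∀ {a w w'}, S.lt w w' → A (a, w) → A (a, w')) ∧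
    ∀ a, P a ↔ ∃ w, A (a, w)

section Semantics

variable {S : Str} {n : ℕ} {α : Type} [Ctx S α]

theorem IndFor.dfn (hI : IndFor S (Sigma0Sigma n)) {P : Unit × S.M → Prop} (h : Dfn S n P)
    (h0 : P ((), S.zero)) (hs : ∀ m, P ((), m) → P ((), S.add m S.one)) (m : S.M) :
    P ((), m) := by
  obtain ⟨φ, hφ, v, e⟩ := h.exists_formula_one
  simp only [e] at *
  exact hI φ hφ v 0 h0 hs m

theorem IndFor.exists_max (hPA : PAminus S) (hI : IndFor S (Sigma0Sigma n))
    {P : Unit × S.M → Prop} (h : Dfn S n P) {s : S.M} (hP : ∃ u, S.lt u s ∧ P ((), u)) :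
    ∃ u, S.lt u s ∧ P ((), u) ∧ ∀ u', S.lt u' s → P ((), u') → ¬ S.lt u u' := by
  by_contra! hcon
  have hQ : Dfn S n fun p : Unit × S.M => ∃ u, S.lt u s ∧ (P ((), u) ∧ ¬ S.lt u p.2) :=
    Dfn.bex (P := fun q : (Unit × S.M) × S.M => P ((), q.2) ∧ ¬ S.lt q.2 q.1.2)
      ((h.comp ((CtxMap.const ()).pair .snd)).and (Dfn.lt .snd (.fst .snd)).not)
      (IsCoord.const s).isTerm
  obtain ⟨u, hu, -, hu'⟩ := hI.dfn hQ
    (by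
      obtain ⟨u, hu, hPu⟩ := hP
      exact ⟨u, hu, hPu, hPA.not_lt_zero u⟩)
    (by
      rintro m ⟨u, hu, hPu, hum⟩
      obtain ⟨u', hu', hPu', huu'⟩ := hcon u hu hPu
      refine ⟨u', hu', hPu', fun hlt => ?_⟩
      have hm : S.lt m u' := by
        rcases hPA.lt_total u m with h | rfl | h
        · exact absurd h hum
        · exact huu'
        · exact hPA.lt_trans _ _ _ h huu'
      rcases hPA.discrete _ _ hm with h | h
      · exact hPA.lt_irrefl _ (h ▸ hlt)
      · exact hPA.lt_irrefl _ (hPA.lt_trans _ _ _ h hlt)) s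
  exact hu' hu

theorem WRFor.dfn (hWR : WRFor S (Sigma0Sigma n)) {P : (Unit × S.M) × S.M → Prop}
    (h : Dfn S n P) {a : S.M} (hP : ∀ m, ∃ k, S.lt k a ∧ P (((), m), k)) :
    ∃ k, S.lt k a ∧ ∀ b, ∃ m, S.lt b m ∧ P (((), m), k) := by
  obtain ⟨φ, hφ, v, e⟩ := h.exists_formula_two
  simp only [e] at *
  exact hWR φ hφ v 1 0 one_ne_zero a hP

theorem WRFor.exists_forall_of_forall_exists (hWR : WRFor S (Sigma0Sigma n))
    {P : (Unit × S.M) × S.M → Prop} (h : Dfn S n P)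
    (anti : ∀ {y s s'}, S.lt s' s → P (((), y), s) → P (((), y), s')) {b : S.M}
    (hP : ∀ s, ∃ y, S.lt y b ∧ P (((), y), s)) : ∃ y, S.lt y b ∧ ∀ s, P (((), y), s) := by
  obtain ⟨y, hy, H⟩ := hWR.dfn (P := fun q => P (((), q.2), q.1.2))
    (h.comp (((CtxMap.const ()).pair .snd).pair (.fst .snd))) hP
  refine ⟨y, hy, fun s => ?_⟩
  obtain ⟨s', hs', h'⟩ := H s
  exact anti hs' h'

theorem MonoRel.collection (hPA : PAminus S) (hWR : WRFor S (Sigma0Sigma n))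
    (hI : IndFor S (Sigma0Sigma n)) {A : ((Unit × S.M) × S.M) × S.M → Prop}
    (hA : MonoRel S n A) {c : S.M} (h : ∀ x, S.lt x c → ∃ w, ∀ s, A ((((), x), w), s)) :
    ∃ w, ∀ x, S.lt x c → ∀ s, A ((((), x), w), s) := by
  by_cases hc : ∃ x, S.lt x c
  swap
  · exact ⟨S.zero, fun x hx => absurd ⟨x, hx⟩ hc⟩
  have hmax : Dfn S n fun q : (Unit × S.M) × S.M => ∀ x', S.lt x' c → ∀ u, S.lt u q.1.2 →
      (¬ A ((((), x'), u), q.1.2) → ¬ A ((((), q.2), u), q.1.2)) := by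
    refine Dfn.ball (P := fun q : ((Unit × S.M) × S.M) × S.M => ∀ u, S.lt u q.1.1.2 →
      (¬ A ((((), q.2), u), q.1.1.2) → ¬ A ((((), q.1.2), u), q.1.1.2))) ?_
      (IsCoord.const c).isTerm
    refine Dfn.ball (P := fun q : (((Unit × S.M) × S.M) × S.M) × S.M =>
      (¬ A ((((), q.1.2), q.2), q.1.1.1.2) → ¬ A ((((), q.1.1.2), q.2), q.1.1.1.2))) ?_
      (IsCoord.snd.fst.fst).isTerm
    exact (hA.dfn.comp ((((CtxMap.const ()).pair (.fst .snd)).pair .snd).pair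
        (.fst (.fst (.fst .snd))))).not.imp
      (hA.dfn.comp ((((CtxMap.const ()).pair (.fst (.fst .snd))).pair .snd).pair
        (.fst (.fst (.fst .snd))))).not
  obtain ⟨x₀, hx₀, H⟩ := hWR.dfn (a := c) hmax (by
    intro s
    by_cases hu : ∃ u, S.lt u s ∧ ∃ x, S.lt x c ∧ ¬ A ((((), x), u), s)
    · have hD : Dfn S n fun p : Unit × S.M => ∃ x, S.lt x c ∧ ¬ A ((((), x), p.2), s) :=
        Dfn.bex (P := fun q : (Unit × S.M) × S.M => ¬ A ((((), q.2), q.1.2), s))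
          (hA.dfn.comp ((((CtxMap.const ()).pair .snd).pair (.fst .snd)).pair
            (.const s))).not (IsCoord.const c).isTerm
      obtain ⟨u, hus, ⟨x, hx, hAx⟩, hmx⟩ := hI.exists_max hPA hD hu
      refine ⟨x, hx, fun x' hx' u' hu' hAx' hAu' => hAx ?_⟩
      rcases hPA.lt_total u u' with hlt | rfl | hlt
      · exact absurd hlt (hmx u' hu' ⟨x', hx', hAx'⟩)
      · exact hAu'
      · exact hA.mono hlt hAu'
    · obtain ⟨x, hx⟩ := hc
      exact ⟨x, hx, fun x' hx' u hus hAx' => absurd ⟨u, hus, x', hx', hAx'⟩ hu⟩)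
  obtain ⟨w, hw⟩ := h x₀ hx₀
  refine ⟨w, fun x hx s => ?_⟩
  obtain ⟨t, hst, hwt⟩ := hPA.exists_gt₂ s w
  obtain ⟨s', hs', H'⟩ := H t
  by_contra hAx
  exact H' x hx w (hPA.lt_trans _ _ _ hwt hs')
    (fun hA' => hAx (hA.anti (hPA.lt_trans _ _ _ hst hs') hA')) (hw s')

theorem ExDfn.of_dfn {P : α → Prop} (h : Dfn S n P) : ExDfn S n P :=
  ⟨fun p => P p.1, h.comp CtxMap.id.fst, fun _ h => h, fun _ => ⟨fun h => ⟨S.zero, h⟩,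
    fun ⟨_, h⟩ => h⟩⟩

theorem ExDfn.ex (hPA : PAminus S) {P : α × S.M → Prop} (h : ExDfn S n P) :
    ExDfn S n fun a => ∃ x, P (a, x) := by
  obtain ⟨A, hA, mono, hP⟩ := h
  refine ⟨fun p => ∃ x, S.lt x p.2 ∧ A ((p.1, x), p.2), ?_, ?_, fun a => ⟨?_, ?_⟩⟩
  · exact Dfn.bex (P := fun q : (α × S.M) × S.M => A ((q.1.1, q.2), q.1.2))
      (hA.comp ((CtxMap.id.fst.fst.pair .snd).pair (.fst .snd))) IsCoord.snd.isTerm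
  · rintro a w w' hw ⟨x, hx, h⟩
    exact ⟨x, hPA.lt_trans _ _ _ hx hw, mono hw h⟩
  · rintro ⟨x, hx⟩
    obtain ⟨w, hw⟩ := (hP _).1 hx
    obtain ⟨w', h1, h2⟩ := hPA.exists_gt₂ x w
    exact ⟨w', x, h1, mono h2 hw⟩
  · rintro ⟨w, x, -, h⟩
    exact ⟨x, (hP _).2 ⟨w, h⟩⟩

theorem ExDfn.exAll {P : α → Prop} (h : ExDfn S n P) : ExAll S n P := by
  obtain ⟨A, hA, mono, hP⟩ := h
  exact ⟨fun p => A p.1, ⟨hA.comp CtxMap.id.fst, mono, fun _ h => h⟩,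
    fun a => (hP a).trans (exists_congr fun _ => ⟨fun h _ => h, fun h => h S.zero⟩)⟩

theorem ExDfn.exAll_not {P : α → Prop} (h : ExDfn S n P) : ExAll S n fun a => ¬ P a := by
  obtain ⟨A, hA, mono, hP⟩ := h
  refine ⟨fun p => ¬ A (p.1.1, p.2), ⟨(hA.comp (CtxMap.id.fst.fst.pair .snd)).not,
    fun _ h => h, fun hs h h' => h (mono hs h')⟩, fun a => ?_⟩
  refine (not_congr (hP a)).trans (not_exists.trans ?_)
  exact ⟨fun h => ⟨S.zero, h⟩, fun ⟨_, h⟩ => h⟩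

theorem ExAll.congr {P Q : α → Prop} (h : ExAll S n P) (e : ∀ a, Q a ↔ P a) : ExAll S n Q :=
  (funext fun a => propext (e a) : Q = P) ▸ h

theorem MonoRel.and {A B : (α × S.M) × S.M → Prop} (hA : MonoRel S n A) (hB : MonoRel S n B) :
    MonoRel S n fun p => A p ∧ B p :=
  ⟨hA.dfn.and hB.dfn, fun hw h => ⟨hA.mono hw h.1, hB.mono hw h.2⟩,
    fun hs h => ⟨hA.anti hs h.1, hB.anti hs h.2⟩⟩

theorem MonoRel.or {A B : (α × S.M) × S.M → Prop} (hA : MonoRel S n A) (hB : MonoRel S n B) :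
    MonoRel S n fun p => A p ∨ B p :=
  ⟨hA.dfn.or hB.dfn, fun hw h => h.imp (hA.mono hw) (hB.mono hw),
    fun hs h => h.imp (hA.anti hs) (hB.anti hs)⟩

theorem MonoRel.forall_or (hPA : PAminus S) {A B : (α × S.M) × S.M → Prop}
    (hA : MonoRel S n A) (hB : MonoRel S n B) {a : α} {w : S.M}
    (h : ∀ s, A ((a, w), s) ∨ B ((a, w), s)) :
    (∀ s, A ((a, w), s)) ∨ ∀ s, B ((a, w), s) := by
  by_contra! hcon
  obtain ⟨⟨s, hs⟩, t, ht⟩ := hcon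
  obtain ⟨r, hr, hr'⟩ := hPA.exists_gt₂ s t
  exact (h r).elim (fun h => hs (hA.anti hr h)) fun h => ht (hB.anti hr' h)

theorem ExAll.and (hPA : PAminus S) {P Q : α → Prop} (h : ExAll S n P) (h' : ExAll S n Q) :
    ExAll S n fun a => P a ∧ Q a := by
  obtain ⟨A, hA, hP⟩ := h
  obtain ⟨B, hB, hQ⟩ := h'
  refine ⟨_, hA.and hB, fun a => (and_congr (hP a) (hQ a)).trans ?_⟩
  constructor
  · rintro ⟨⟨w, hw⟩, w', hw'⟩
    obtain ⟨u, hu, hu'⟩ := hPA.exists_gt₂ w w'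
    exact ⟨u, fun s => ⟨hA.mono hu (hw s), hB.mono hu' (hw' s)⟩⟩
  · rintro ⟨w, hw⟩
    exact ⟨⟨w, fun s => (hw s).1⟩, w, fun s => (hw s).2⟩

theorem ExAll.or (hPA : PAminus S) {P Q : α → Prop} (h : ExAll S n P) (h' : ExAll S n Q) :
    ExAll S n fun a => P a ∨ Q a := by
  obtain ⟨A, hA, hP⟩ := h
  obtain ⟨B, hB, hQ⟩ := h'
  refine ⟨_, hA.or hB, fun a => (or_congr (hP a) (hQ a)).trans ?_⟩
  constructor
  · rintro (⟨w, hw⟩ | ⟨w, hw⟩)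
    · exact ⟨w, fun s => .inl (hw s)⟩
    · exact ⟨w, fun s => .inr (hw s)⟩
  · rintro ⟨w, hw⟩
    exact (hA.forall_or hPA hB hw).imp (fun h => ⟨w, h⟩) fun h => ⟨w, h⟩

/-- Bounding an existential coordinate by the monotone one. -/
theorem MonoRel.exists_lt (hPA : PAminus S) {A : ((α × S.M) × S.M) × S.M → Prop}
    (hA : MonoRel S n A) :
    MonoRel S n fun p : (α × S.M) × S.M =>
      ∃ x, S.lt x p.1.2 ∧ A (((p.1.1, x), p.1.2), p.2) where
  dfn := Dfn.bex (P := fun q : ((α × S.M) × S.M) × S.M => A (((q.1.1.1, q.2), q.1.1.2), q.1.2))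
    (hA.dfn.comp (((CtxMap.id.fst.fst.fst.pair .snd).pair (.fst (.fst .snd))).pair (.fst .snd)))
    (IsCoord.snd.fst).isTerm
  mono := by
    rintro a w w' s hw ⟨x, hx, h⟩
    exact ⟨x, hPA.lt_trans _ _ _ hx hw, hA.mono hw h⟩
  anti := by
    rintro a w s s' hs ⟨x, hx, h⟩
    exact ⟨x, hx, hA.anti hs h⟩

theorem MonoRel.exists_forall (hWR : WRFor S (Sigma0Sigma n))
    {A : ((α × S.M) × S.M) × S.M → Prop} (hA : MonoRel S n A) {a : α} {w b : S.M}
    (h : ∀ s, ∃ x, S.lt x b ∧ A (((a, x), w), s)) :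
    ∃ x, S.lt x b ∧ ∀ s, A (((a, x), w), s) :=
  hWR.exists_forall_of_forall_exists (P := fun q => A (((a, q.1.2), w), q.2))
    (hA.dfn.comp ((((CtxMap.const a).pair (.fst .snd)).pair (.const w)).pair .snd))
    (fun hs h => hA.anti hs h) h

theorem ExAll.ex (hPA : PAminus S) (hWR : WRFor S (Sigma0Sigma n)) {P : α × S.M → Prop}
    (h : ExAll S n P) : ExAll S n fun a => ∃ x, P (a, x) := by
  obtain ⟨A, hA, hP⟩ := h
  refine ⟨_, hA.exists_lt hPA, fun a => ⟨?_, ?_⟩⟩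
  · rintro ⟨x, hx⟩
    obtain ⟨w, hw⟩ := (hP _).1 hx
    obtain ⟨w', h1, h2⟩ := hPA.exists_gt₂ x w
    exact ⟨w', fun s => ⟨x, h1, hA.mono h2 (hw s)⟩⟩
  · rintro ⟨w, hw⟩
    obtain ⟨x, -, hx⟩ := hA.exists_forall hWR hw
    exact ⟨x, (hP _).2 ⟨w, hx⟩⟩

theorem ExAll.bex (hWR : WRFor S (Sigma0Sigma n)) {P : α × S.M → Prop}
    (h : ExAll S n P) {g : α → S.M} (hg : IsTerm S g) :
    ExAll S n fun a => ∃ x, S.lt x (g a) ∧ P (a, x) := by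
  obtain ⟨A, hA, hP⟩ := h
  refine ⟨fun p => ∃ x, S.lt x (g p.1.1) ∧ A (((p.1.1, x), p.1.2), p.2), ⟨?_, ?_, ?_⟩,
    fun a => ⟨?_, ?_⟩⟩
  · exact Dfn.bex (P := fun q : ((α × S.M) × S.M) × S.M =>
      A (((q.1.1.1, q.2), q.1.1.2), q.1.2)) (hA.dfn.comp (((CtxMap.id.fst.fst.fst.pair
        .snd).pair (.fst (.fst .snd))).pair (.fst .snd))) hg.fst.fst
  · rintro a w w' s hw ⟨x, hx, h⟩
    exact ⟨x, hx, hA.mono hw h⟩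
  · rintro a w s s' hs ⟨x, hx, h⟩
    exact ⟨x, hx, hA.anti hs h⟩
  · rintro ⟨x, hx, h⟩
    obtain ⟨w, hw⟩ := (hP _).1 h
    exact ⟨w, fun s => ⟨x, hx, hw s⟩⟩
  · rintro ⟨w, hw⟩
    obtain ⟨x, hxg, hx⟩ := hA.exists_forall hWR (b := g a) hw
    exact ⟨x, hxg, (hP _).2 ⟨w, hx⟩⟩

theorem ExAll.ball (hPA : PAminus S) (hWR : WRFor S (Sigma0Sigma n))
    (hI : IndFor S (Sigma0Sigma n)) {P : α × S.M → Prop}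
    (h : ExAll S n P) {g : α → S.M} (hg : IsTerm S g) :
    ExAll S n fun a => ∀ x, S.lt x (g a) → P (a, x) := by
  obtain ⟨A, hA, hP⟩ := h
  refine ⟨fun p => ∀ x, S.lt x (g p.1.1) → A (((p.1.1, x), p.1.2), p.2), ⟨?_, ?_, ?_⟩,
    fun a => ⟨?_, ?_⟩⟩
  · exact Dfn.ball (P := fun q : ((α × S.M) × S.M) × S.M =>
      A (((q.1.1.1, q.2), q.1.1.2), q.1.2)) (hA.dfn.comp (((CtxMap.id.fst.fst.fst.pair
        .snd).pair (.fst (.fst .snd))).pair (.fst .snd))) hg.fst.fst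
  · intro a w w' s hw h x hx
    exact hA.mono hw (h x hx)
  · intro a w s s' hs h x hx
    exact hA.anti hs (h x hx)
  · intro h
    have hB : MonoRel S n fun q : ((Unit × S.M) × S.M) × S.M =>
        A (((a, q.1.1.2), q.1.2), q.2) :=
      ⟨hA.dfn.comp ((((CtxMap.const a).pair (.fst (.fst .snd))).pair (.fst .snd)).pair .snd),
        fun hw h => hA.mono hw h, fun hs h => hA.anti hs h⟩
    obtain ⟨w, hw⟩ := hB.collection hPA hWR hI fun x hx => (hP _).1 (h x hx)
    exact ⟨w, fun s x hx => hw x hx s⟩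
  · rintro ⟨w, hw⟩ x hx
    exact (hP _).2 ⟨w, fun s => hw s x hx⟩

/-- Induction for relations which are `∃∀` and `∀∃` over `Σ₀(Σₙ)`. -/
theorem ExAll.induction (hPA : PAminus S) (hWR : WRFor S (Sigma0Sigma n))
    (hI : IndFor S (Sigma0Sigma n)) {P : Unit × S.M → Prop} (h : ExAll S n P)
    (h' : ExAll S n fun a => ¬ P a) (h0 : P ((), S.zero))
    (hs : ∀ m, P ((), m) → P ((), S.add m S.one)) (m : S.M) : P ((), m) := by
  obtain ⟨A, hA, hP⟩ := h
  obtain ⟨B, hB, hQ⟩ := h'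
  obtain ⟨w, hw⟩ := (hA.or hB).collection hPA hWR hI (c := S.add m S.one) (by
    intro x _
    by_cases hx : P ((), x)
    · obtain ⟨w, hw⟩ := (hP _).1 hx
      exact ⟨w, fun s => .inl (hw s)⟩
    · obtain ⟨w, hw⟩ := (hQ _).1 hx
      exact ⟨w, fun s => .inr (hw s)⟩)
  have hnot : ∀ x, (∀ s, A ((((), x), w), s)) → ¬ ∀ s, B ((((), x), w), s) :=
    fun x h h' => (hQ _).2 ⟨w, h'⟩ ((hP _).2 ⟨w, h⟩)
  have hC : MonoRel S n fun q : ((Unit × S.M) × S.M) × S.M =>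
      ¬ (A ((q.1.1, w), q.1.2) ∧ B ((q.1.1, w), q.1.2)) := by
    have hmap : CtxMap S fun q : ((Unit × S.M) × S.M) × S.M => ((q.1.1, w), q.1.2) :=
      (CtxMap.id.fst.fst.pair (.const w)).pair (.fst .snd)
    exact ⟨((hA.dfn.comp hmap).and (hB.dfn.comp hmap)).not,
      fun hw h h' => h ⟨hA.anti hw h'.1, hB.anti hw h'.2⟩, fun _ h => h⟩
  obtain ⟨r, hr⟩ := hC.collection hPA hWR hI (c := S.add m S.one) (by
    intro x _
    by_contra! hcon
    refine hnot x (fun s => ?_) fun s => ?_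
    · exact (hcon s).elim fun _ h => h.1
    · exact (hcon s).elim fun _ h => h.2)
  have key : ∀ x, S.lt x (S.add m S.one) → (P ((), x) ↔ A ((((), x), w), r)) := by
    intro x hx
    rcases hA.forall_or hPA hB (hw x hx) with h | h
    · exact iff_of_true ((hP _).2 ⟨w, h⟩) (h r)
    · exact iff_of_false ((hQ _).2 ⟨w, h⟩) fun h' => hr x hx S.zero ⟨h', h r⟩
  have hD : Dfn S n fun p : Unit × S.M => S.lt p.2 (S.add m S.one) → A ((p, w), r) :=
    (Dfn.lt .snd (.const _)).imp (hA.dfn.comp ((CtxMap.id.pair (.const w)).pair (.const r)))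
  refine (key m (hPA.lt_succ m)).2 (hI.dfn hD (fun hx => (key _ hx).1 h0) ?_ m (hPA.lt_succ m))
  intro x ih hx
  have hx' := hPA.lt_trans _ _ _ (hPA.lt_succ x) hx
  exact (key _ hx).1 (hs x ((key x hx').2 (ih hx')))

end Semantics

/-! ## Relations defined by formulas -/

section Formulas

variable {S : Str} {n : ℕ} {α : Type} [Ctx S α]

/-- Extension of a list of coordinates by a new variable. -/
def extCoord {S : Str} {α : Type} (e : ℕ → α → S.M) (x : ℕ) : ℕ → α × S.M → S.M :=
  upd (fun i p => e i p.1) x Prod.snd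

theorem isCoord_extCoord {e : ℕ → α → S.M} (he : ∀ i, IsCoord S (e i)) (x i : ℕ) :
    IsCoord S (extCoord e x i) := by
  unfold extCoord upd
  split_ifs
  · exact IsCoord.snd
  · exact (he i).fst

theorem extCoord_apply {α : Type} (e : ℕ → α → S.M) (x : ℕ) (a : α) (m : S.M) :
    (fun i => extCoord e x i (a, m)) = upd (fun i => e i a) x m := by
  funext i
  by_cases h : i = x <;> simp [extCoord, upd, h]

theorem dfn_sat {φ : Fml} (h : Sigma0Sigma n φ) {e : ℕ → α → S.M}
    (he : ∀ i, IsCoord S (e i)) : Dfn S n fun a => Sat0 S (fun i => e i a) φ :=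
  ⟨φ, h, e, he, fun _ => Iff.rfl⟩

theorem IsPi.dfn_sat {φ : Fml} (h : IsPi n φ) {e : ℕ → α → S.M}
    (he : ∀ i, IsCoord S (e i)) : Dfn S n fun a => Sat0 S (fun i => e i a) φ := by
  obtain ⟨ψ, hψ, eψ⟩ := h.exists_dual S
  exact (PaperArith.dfn_sat (Sigma0Sigma.ofSigma hψ).not he).congr fun a =>
    (not_not.symm.trans (not_congr (eψ _)).symm)

theorem IsSigma.exDfn_sat (hPA : PAminus S) : ∀ {φ : Fml}, IsSigma (n + 1) φ →
    ∀ {α : Type} [Ctx S α] {e : ℕ → α → S.M}, (∀ i, IsCoord S (e i)) →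
      ExDfn S n fun a => Sat0 S (fun i => e i a) φ
  | _, .delta0 h, _, _, _, he => .of_dfn (dfn_sat (.ofSigma (.delta0 h)) he)
  | _, .ofPi h, _, _, _, he => .of_dfn (h.dfn_sat he)
  | _, .ex x h, _, _, e, he => by
    have := ExDfn.ex hPA (h.exDfn_sat hPA (isCoord_extCoord he x))
    simp only [extCoord_apply] at this
    exact this

theorem IsSigma.exAll_sat (hPA : PAminus S) (hWR : WRFor S (Sigma0Sigma n)) :
    ∀ {φ : Fml}, IsSigma (n + 2) φ →
    ∀ {α : Type} [Ctx S α] {e : ℕ → α → S.M}, (∀ i, IsCoord S (e i)) →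
      ExAll S n fun a => Sat0 S (fun i => e i a) φ
  | _, .delta0 h, _, _, _, he => (ExDfn.of_dfn (dfn_sat (.ofSigma (.delta0 h)) he)).exAll
  | _, .ofPi h, _, _, _, he => by
    obtain ⟨ψ, hψ, eψ⟩ := h.exists_dual S
    exact (hψ.exDfn_sat hPA he).exAll_not.congr fun a =>
      (not_not.symm.trans (not_congr (eψ _)).symm)
  | _, .ex x h, _, _, e, he => by
    have := ExAll.ex hPA hWR (h.exAll_sat hPA hWR (isCoord_extCoord he x))
    simp only [extCoord_apply] at this
    exact this

theorem Sigma0Sigma.exAll_sat (hPA : PAminus S) (hWR : WRFor S (Sigma0Sigma n))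
    (hI : IndFor S (Sigma0Sigma n)) {φ : Fml} (h : Sigma0Sigma (n + 1) φ) :
    ∀ {α : Type} [Ctx S α] {e : ℕ → α → S.M}, (∀ i, IsCoord S (e i)) →
      ExAll S n (fun a => Sat0 S (fun i => e i a) φ) ∧
        ExAll S n fun a => ¬ Sat0 S (fun i => e i a) φ := by
  induction h with
  | ofSigma h =>
    intro α _ e he
    have := h.exDfn_sat hPA he
    exact ⟨this.exAll, this.exAll_not⟩
  | not _ ih =>
    intro α _ e he
    exact ⟨(ih he).2, (ih he).1.congr fun a => not_not⟩
  | and _ _ ih ih' =>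
    intro α _ e he
    exact ⟨(ih he).1.and hPA (ih' he).1, ((ih he).2.or hPA (ih' he).2).congr fun a => not_and_or⟩
  | or _ _ ih ih' =>
    intro α _ e he
    exact ⟨(ih he).1.or hPA (ih' he).1, ((ih he).2.and hPA (ih' he).2).congr fun a => not_or⟩
  | imp _ _ ih ih' =>
    intro α _ e he
    exact ⟨((ih he).2.or hPA (ih' he).1).congr fun a => imp_iff_not_or,
      ((ih he).1.and hPA (ih' he).2).congr fun a => Classical.not_imp⟩
  | ball x t _ ih =>
    intro α _ e he
    obtain ⟨h1, h2⟩ := ih (isCoord_extCoord he x)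
    have ht : IsTerm S fun a => tval S (fun i => e i a) t := ⟨t, e, he, fun _ => rfl⟩
    refine ⟨(h1.ball hPA hWR hI ht).congr fun a => ?_, (h2.bex hWR ht).congr fun a => ?_⟩
    · simp only [extCoord_apply]
      rfl
    · simp only [extCoord_apply, Sat0, Sat, not_forall, exists_prop]
  | bex x t _ ih =>
    intro α _ e he
    obtain ⟨h1, h2⟩ := ih (isCoord_extCoord he x)
    have ht : IsTerm S fun a => tval S (fun i => e i a) t := ⟨t, e, he, fun _ => rfl⟩
    refine ⟨(h1.bex hWR ht).congr fun a => ?_, (h2.ball hPA hWR hI ht).congr fun a => ?_⟩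
    · simp only [extCoord_apply]
      rfl
    · simp only [extCoord_apply, Sat0, Sat, not_exists, not_and]

theorem WRFor.indFor (hPA : PAminus S) (hI : IndFor S Delta0) :
    ∀ n, WRFor S (Sigma0Sigma n) → IndFor S (Sigma0Sigma n)
  | 0, _ => fun φ hφ => hI φ hφ.delta0
  | n + 1, hWR => by
    have hWR' : WRFor S (Sigma0Sigma n) := fun φ hφ => hWR φ hφ.succ
    have hI' := WRFor.indFor hPA hI n hWR'
    intro φ hφ v x h0 hs m
    obtain ⟨h1, h2⟩ := hφ.exAll_sat hPA hWR' hI'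
      (isCoord_extCoord (α := Unit) (fun i => IsCoord.const (v i)) x)
    have := ExAll.induction hPA hWR' hI' h1 h2
    simp only [extCoord_apply] at this
    exact this h0 hs m

theorem WRFor.collFor (hPA : PAminus S) (hWR : WRFor S (Sigma0Sigma n))
    (hI : IndFor S (Sigma0Sigma n)) : CollFor S (IsSigma (n + 2)) := by
  intro φ hφ v x y _ a h
  obtain ⟨A, hA, hP⟩ := hφ.exAll_sat hPA hWR
    (isCoord_extCoord (isCoord_extCoord (α := Unit) (fun i => IsCoord.const (v i)) x) y)
  have hP' : ∀ m k, Sat0 S (upd (upd v x m) y k) φ ↔ ∃ w, ∀ s, A (((((), m), k), w), s) := by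
    intro m k
    rw [← hP]
    simp only [extCoord_apply]
  obtain ⟨w, hw⟩ := (hA.exists_lt hPA).collection hPA hWR hI (c := a) (by
    intro m hm
    obtain ⟨k, hk⟩ := h m hm
    obtain ⟨w, hw⟩ := (hP' m k).1 hk
    obtain ⟨w', h1, h2⟩ := hPA.exists_gt₂ k w
    exact ⟨w', fun s => ⟨k, h1, hA.mono h2 (hw s)⟩⟩)
  refine ⟨w, fun m hm => ?_⟩
  obtain ⟨k, hk, H⟩ := hA.exists_forall hWR (hw m hm)
  exact ⟨k, hk, (hP' m k).2 ⟨w, H⟩⟩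

end Formulas

/-- Lemma `lem:rpi->B1`.
For each `n ∈ ℕ`, `WRΣ₀(Σₙ) ⊢ BΣₙ₊₂`: every model of `IΔ₀` satisfying the
weak regularity principle for all `Σ₀(Σₙ)` formulas satisfies the
`Σₙ₊₂`-collection scheme. -/
theorem statement_15 (n : ℕ) (S : Str) (h1 : IDelta0 S)
    (h2 : WRFor S (Sigma0Sigma n)) :
    BSigma S (n + 2) := by
  have hI := WRFor.indFor h1.1 h1.2 n h2
  exact ⟨h1, WRFor.collFor h1.1 h2 hI⟩

end PaperArith
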